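/- arXiv:2506.02259 — 9 statements merged into one kernel-verified Lean document; each statement's English description precedes it below -/
import Mathlib

section
/- Let Σ be a finite nonempty set and let J be a joint probability mass function on Σ×Σ for the signal pair (X_a, X_b), with Alice-marginal M^a(σ) = Σ_{σ'} J(σ,σ'). Assume signals are self-dominating, i.e., for every σ and every σ' ≠ σ, J(σ,σ) > J(σ,σ'). Then for every strategy θ : Σ → (probability vectors on Σ) (so θ(σ)(σ') ≥ 0 and Σ_{σ'} θ(σ)(σ') = 1), the expected agreement probability under θ is at most that of truth-telling: Σ_{σ,σ'} J(σ,σ')·θ(σ)(σ') ≤ Σ_σ J(σ,σ). (Truthfulness of the Output Agreement mechanism.) -/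
/-- Truthfulness of the Output Agreement mechanism: if signals are self-dominating,
then for every strategy `θ` the expected agreement probability is at most that of
truth-telling. -/
theorem oa_truthful {S : Type*} [Fintype S] [Nonempty S]
    (J : S → S → ℝ)
    (hJ0 : ∀ σ σ', 0 ≤ J σ σ')
    (hJ1 : ∑ σ, ∑ σ', J σ σ' = 1)
    (hSD : ∀ σ σ', σ' ≠ σ → J σ σ' < J σ σ)
    (θ : S → S → ℝ)
    (hθ0 : ∀ σ σ', 0 ≤ θ σ σ')
    (hθ1 : ∀ σ, ∑ σ', θ σ σ' = 1) :
    ∑ σ, ∑ σ', J σ σ' * θ σ σ' ≤ ∑ σ, J σ σ := by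
  refine Finset.sum_le_sum fun σ _ => ?_
  calc ∑ σ', J σ σ' * θ σ σ' ≤ ∑ σ', J σ σ * θ σ σ' := by
        refine Finset.sum_le_sum fun σ' _ => mul_le_mul_of_nonneg_right ?_ (hθ0 σ σ')
        rcases eq_or_ne σ' σ with rfl | h
        · exact le_rfl
        · exact (hSD σ σ' h).le
    _ = J σ σ := by rw [← Finset.mul_sum, hθ1, mul_one]
end

section
/- Let Σ be a finite nonempty set and let J be a joint probability mass function on Σ×Σ that is self-dominating, i.e., for every σ and every σ' ≠ σ, J(σ,σ) > J(σ,σ'). Let q_τ = Σ_σ J(σ,σ) and, for any strategy θ : Σ → (probability vectors on Σ), let q_θ = Σ_{σ,σ'} J(σ,σ')·θ(σ)(σ'). Then for every n ≥ 1 and every strategy θ, the binomial distribution Bin(n, q_τ) first-order stochastically dominates Bin(n, q_θ). (SD-truthfulness of the Output Agreement mechanism on n i.i.d. questions, whose final score is (1/n)·Bin(n, q).) -/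
/-- The probability mass function of the binomial distribution `Bin(n, p)`. -/
noncomputable def binomPMF (n : ℕ) (p : ℝ) : ℕ → ℝ :=
  fun k => (n.choose k : ℝ) * p ^ k * (1 - p) ^ (n - k)

/-- First-order stochastic dominance of `f` over `g`, for (sub)probability mass
functions on `ℕ`: `Pr_f(X ≥ t) ≥ Pr_g(Y ≥ t)` for every real threshold `t`. -/
def FOSD (f g : ℕ → ℝ) : Prop :=
  ∀ t : ℝ, ∑' k : ℕ, (if t ≤ (k : ℝ) then g k else 0) ≤
    ∑' k : ℕ, (if t ≤ (k : ℝ) then f k else 0)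

/-- Pascal's rule for the binomial probability mass function. -/
theorem binomPMF_succ_succ (n : ℕ) (p : ℝ) (k : ℕ) :
    binomPMF (n + 1) p (k + 1) = p * binomPMF n p k + (1 - p) * binomPMF n p (k + 1) := by
  unfold binomPMF
  rw [Nat.choose_succ_succ, Nat.add_sub_add_right]
  push_cast
  rcases Nat.lt_or_ge k n with h | h
  · obtain ⟨d, rfl⟩ := Nat.exists_eq_add_of_lt h
    rw [show k + d + 1 - k = d + 1 by omega, show k + d + 1 - (k + 1) = d by omega]
    ring
  · rw [Nat.choose_eq_zero_of_lt (Nat.lt_succ_of_le h)]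
    push_cast
    ring

theorem binomPMF_succ_zero (n : ℕ) (p : ℝ) :
    binomPMF (n + 1) p 0 = (1 - p) * binomPMF n p 0 := by
  simp [binomPMF, pow_succ']

theorem binomPMF_eq_zero_of_lt {n k : ℕ} (h : n < k) (p : ℝ) : binomPMF n p k = 0 := by
  simp [binomPMF, Nat.choose_eq_zero_of_lt h]

theorem binomPMF_nonneg {p : ℝ} (h0 : 0 ≤ p) (h1 : p ≤ 1) (n k : ℕ) : 0 ≤ binomPMF n p k := by
  have := sub_nonneg.2 h1
  unfold binomPMF
  positivity

/-- Conditioning the expectation of `g` under `Bin(n + 1, p)` on one trial. -/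
theorem sum_binomPMF_succ_mul (n : ℕ) (p : ℝ) (g : ℕ → ℝ) :
    ∑ k ∈ Finset.range (n + 2), binomPMF (n + 1) p k * g k =
      p * ∑ k ∈ Finset.range (n + 1), binomPMF n p k * g (k + 1) +
        (1 - p) * ∑ k ∈ Finset.range (n + 1), binomPMF n p k * g k := by
  have h : ∑ k ∈ Finset.range (n + 1), binomPMF n p k * g k =
      ∑ k ∈ Finset.range (n + 2), binomPMF n p k * g k := by
    rw [Finset.sum_range_succ _ (n + 1), binomPMF_eq_zero_of_lt n.lt_succ_self]
    ring
  rw [h, Finset.sum_range_succ' _ (n + 1), Finset.sum_range_succ' _ (n + 1), binomPMF_succ_zero,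
    mul_add, ← add_assoc, Finset.mul_sum, Finset.mul_sum, ← Finset.sum_add_distrib, mul_assoc]
  congr 1
  refine Finset.sum_congr rfl fun k _ => ?_
  rw [binomPMF_succ_succ]
  ring

/-- The expectation of a monotone function under `Bin(n, p)` is monotone in `p`. -/
theorem sum_binomPMF_mul_le {p q : ℝ} (hq : 0 ≤ q) (hqp : q ≤ p) (hp : p ≤ 1) (n : ℕ)
    {g : ℕ → ℝ} (hg : Monotone g) :
    ∑ k ∈ Finset.range (n + 1), binomPMF n q k * g k ≤
      ∑ k ∈ Finset.range (n + 1), binomPMF n p k * g k := by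
  induction n generalizing g with
  | zero => simp [binomPMF]
  | succ n ih =>
    rw [sum_binomPMF_succ_mul, sum_binomPMF_succ_mul]
    have h₁ := ih hg
    have h₂ := ih (g := fun k => g (k + 1)) fun a b hab => hg (Nat.succ_le_succ hab)
    have h₃ : ∑ k ∈ Finset.range (n + 1), binomPMF n q k * g k ≤
        ∑ k ∈ Finset.range (n + 1), binomPMF n q k * g (k + 1) :=
      Finset.sum_le_sum fun k _ =>
        mul_le_mul_of_nonneg_left (hg k.le_succ) (binomPMF_nonneg hq (hqp.trans hp) n k)
    have h₄ := mul_le_mul_of_nonneg_left h₁ (sub_nonneg.2 hp)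
    have h₅ := mul_le_mul_of_nonneg_left h₂ (hq.trans hqp)
    have h₆ := mul_le_mul_of_nonneg_left h₃ (sub_nonneg.2 hqp)
    linarith

theorem tsum_binomPMF_tail (n : ℕ) (p t : ℝ) :
    ∑' k : ℕ, (if t ≤ (k : ℝ) then binomPMF n p k else 0) =
      ∑ k ∈ Finset.range (n + 1), binomPMF n p k * (if t ≤ (k : ℝ) then 1 else 0) := by
  rw [tsum_eq_sum (s := Finset.range (n + 1))]
  · simp only [mul_ite, mul_one, mul_zero]
  · intro k hk
    rw [binomPMF_eq_zero_of_lt (not_le.1 fun h => hk (Finset.mem_range_succ_iff.2 h)), ite_self]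

/-- Binomial distributions are stochastically increasing in the success probability. -/
theorem fosd_binomPMF {p q : ℝ} (hq : 0 ≤ q) (hqp : q ≤ p) (hp : p ≤ 1) (n : ℕ) :
    FOSD (binomPMF n p) (binomPMF n q) := by
  intro t
  rw [tsum_binomPMF_tail, tsum_binomPMF_tail]
  refine sum_binomPMF_mul_le hq hqp hp n fun a b hab => ?_
  have hab' : (a : ℝ) ≤ b := Nat.cast_le.2 hab
  split_ifs with ha hb
  · exact le_rfl
  · exact absurd (ha.trans hab') hb
  · exact zero_le_one
  · exact le_rfl

/-- SD-truthfulness of the Output Agreement mechanism on `n` i.i.d. questions: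
if signals are self-dominating, then `Bin(n, q_τ)` first-order stochastically
dominates `Bin(n, q_θ)` for every strategy `θ`, where `q_τ = ∑ σ, J σ σ` is the
agreement probability under truth-telling and `q_θ` the one under `θ`. -/
theorem oa_sd_truthful {S : Type*} [Fintype S] [Nonempty S]
    (J : S → S → ℝ)
    (hJ0 : ∀ σ σ', 0 ≤ J σ σ')
    (hJ1 : ∑ σ, ∑ σ', J σ σ' = 1)
    (hSD : ∀ σ σ', σ' ≠ σ → J σ σ' < J σ σ)
    (θ : S → S → ℝ)
    (hθ0 : ∀ σ σ', 0 ≤ θ σ σ')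
    (hθ1 : ∀ σ, ∑ σ', θ σ σ' = 1)
    (n : ℕ) (hn : 1 ≤ n) :
    FOSD (binomPMF n (∑ σ, J σ σ)) (binomPMF n (∑ σ, ∑ σ', J σ σ' * θ σ σ')) := by
  refine fosd_binomPMF
    (Finset.sum_nonneg fun σ _ => Finset.sum_nonneg fun σ' _ => mul_nonneg (hJ0 σ σ') (hθ0 σ σ'))
    (Finset.sum_le_sum fun σ _ => ?_) ?_ n
  · calc ∑ σ', J σ σ' * θ σ σ' ≤ ∑ σ', J σ σ * θ σ σ' := by
          refine Finset.sum_le_sum fun σ' _ => mul_le_mul_of_nonneg_right ?_ (hθ0 σ σ')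
          rcases eq_or_ne σ' σ with rfl | h
          · exact le_rfl
          · exact (hSD σ σ' h).le
      _ = J σ σ := by rw [← Finset.mul_sum, hθ1, mul_one]
  · rw [← hJ1]
    exact Finset.sum_le_sum fun σ _ =>
      Finset.single_le_sum (f := J σ) (fun σ' _ => hJ0 σ σ') (Finset.mem_univ σ)
end

section
/- Let a < b be real numbers and let m : ℝ → ℝ be differentiable at e with a < m(e) < b, representing the expected score of a mechanism at effort e, and let s(e) > 0 be the standard deviation of its score at effort e. Define λ(e) = (m(e) − a)/(b − a), so the direct-rounded score at effort e is Bernoulli(λ(e)). Then the sensitivity of the direct rounding, δ̃(e) := λ'(e)/√(λ(e)(1 − λ(e))), satisfies δ̃(e) = m'(e)/√((m(e) − a)(b − m(e))), and hence the ratio of the original sensitivity δ(e) := m'(e)/s(e) to δ̃(e) equals √((b − m(e))(m(e) − a))/s(e). -/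
/-- The sensitivity of the direct rounding reduction.  With `λ(e) = (m(e) − a)/(b − a)`,
the sensitivity `δ̃(e) = λ'(e)/√(λ(e)(1 − λ(e)))` of the Bernoulli(`λ(e)`) rounded score
equals `m'(e)/√((m(e) − a)(b − m(e)))`, and consequently the original sensitivity
`δ(e) = m'(e)/s(e)` equals `√((b − m(e))(m(e) − a))/s(e)` times `δ̃(e)`. -/
theorem direct_rounding_sensitivity (a b e : ℝ) (hab : a < b)
    (m : ℝ → ℝ) (hm : DifferentiableAt ℝ m e)
    (h1 : a < m e) (h2 : m e < b)
    (s : ℝ → ℝ) (hs : 0 < s e) :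
    deriv (fun x => (m x - a) / (b - a)) e /
        Real.sqrt (((m e - a) / (b - a)) * (1 - (m e - a) / (b - a)))
      = deriv m e / Real.sqrt ((m e - a) * (b - m e)) ∧
    deriv m e / s e
      = (Real.sqrt ((b - m e) * (m e - a)) / s e) *
          (deriv (fun x => (m x - a) / (b - a)) e /
            Real.sqrt (((m e - a) / (b - a)) * (1 - (m e - a) / (b - a)))) := by
  have hba : 0 < b - a := sub_pos.2 hab
  have hpos : 0 < (m e - a) * (b - m e) := mul_pos (sub_pos.2 h1) (sub_pos.2 h2)
  have hderiv : deriv (fun x => (m x - a) / (b - a)) e = deriv m e / (b - a) :=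
    ((hm.hasDerivAt.sub_const a).div_const (b - a)).deriv
  have hvar : (m e - a) / (b - a) * (1 - (m e - a) / (b - a))
      = (m e - a) * (b - m e) / (b - a) ^ 2 := by
    field_simp
    ring
  have hstd : Real.sqrt ((m e - a) / (b - a) * (1 - (m e - a) / (b - a)))
      = Real.sqrt ((m e - a) * (b - m e)) / (b - a) := by
    rw [hvar, Real.sqrt_div hpos.le, Real.sqrt_sq hba.le]
  have hsens : deriv (fun x => (m x - a) / (b - a)) e /
        Real.sqrt ((m e - a) / (b - a) * (1 - (m e - a) / (b - a)))
      = deriv m e / Real.sqrt ((m e - a) * (b - m e)) := by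
    rw [hderiv, hstd, div_div_div_cancel_right₀ hba.ne']
  refine ⟨hsens, ?_⟩
  have hsqrt : Real.sqrt ((m e - a) * (b - m e)) ≠ 0 := (Real.sqrt_pos.2 hpos).ne'
  rw [hsens, mul_comm (b - m e)]
  field_simp
end

section
/- Let p_{00}, p_{01}, p_{10}, p_{11} ∈ [0,1] satisfy p_{00} ≥ p_{10} and p_{11} ≥ p_{01}. Let n_0, m_0, m_1 be nonnegative integers with n_0 ≤ m_0, and let k be an integer with 0 ≤ k ≤ min(n_0, m_1). Then the distribution of the sum of independent binomials Bin(n_0, p_{00}) + Bin(m_1, p_{11}) + Bin(m_0 − n_0, p_{01}) first-order stochastically dominates the distribution of the sum of independent binomials Bin(n_0 − k, p_{00}) + Bin(m_1 − k, p_{11}) + Bin(m_0 − n_0 + k, p_{01}) + Bin(k, p_{10}). (This is the distributional content of the theorem that the Enforced Agreement mechanism is SD-truthful in the binary-signal setting with self-predicting signals: the first sum is n·S(τ) under truth-telling and the second is n·S(θ) under an arbitrary deviation moving k reports.) -/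
/-- Convolution of two mass functions on `ℕ` (the mass function of the sum of two
independent `ℕ`-valued random variables). -/
noncomputable def nconv (f g : ℕ → ℝ) : ℕ → ℝ :=
  fun k => ∑ i ∈ Finset.range (k + 1), f i * g (k - i)

open Polynomial in
/-- The probability generating function of a Bernoulli variable of parameter `p`. -/
noncomputable def bernoulliGF (p : ℝ) : ℝ[X] := C p * X + C (1 - p)

open Polynomial in
/-- `F` is obtained from `G` by moving nonnegative mass upwards. -/
def GFDominates (F G : ℝ[X]) : Prop :=
  ∃ H : ℝ[X], (∀ i, 0 ≤ H.coeff i) ∧ F - G = (X - 1) * H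

open Polynomial in
lemma coeff_mul_nonneg {F G : ℝ[X]} (hF : ∀ i, 0 ≤ F.coeff i) (hG : ∀ i, 0 ≤ G.coeff i) (i : ℕ) :
    0 ≤ (F * G).coeff i := by
  rw [coeff_mul]
  exact Finset.sum_nonneg fun x _ => mul_nonneg (hF _) (hG _)

open Polynomial in
lemma coeff_pow_nonneg {F : ℝ[X]} (hF : ∀ i, 0 ≤ F.coeff i) (n i : ℕ) :
    0 ≤ (F ^ n).coeff i := by
  induction n generalizing i with
  | zero =>
    rw [pow_zero, coeff_one]
    split_ifs <;> norm_num
  | succ n ih => exact pow_succ F n ▸ coeff_mul_nonneg ih hF i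

open Polynomial in
lemma coeff_bernoulliGF_nonneg {p : ℝ} (h0 : 0 ≤ p) (h1 : p ≤ 1) (i : ℕ) :
    0 ≤ (bernoulliGF p).coeff i := by
  rw [bernoulliGF, coeff_add, coeff_C_mul, coeff_X, coeff_C]
  have := sub_nonneg.2 h1
  split_ifs <;> simp [h0, h1]

open Polynomial in
lemma binomPMF_eq_coeff (n : ℕ) (p : ℝ) : binomPMF n p = ((bernoulliGF p) ^ n).coeff := by
  funext k
  have hterm (m : ℕ) : (C p * X) ^ m * C (1 - p) ^ (n - m) * (n.choose m : ℝ[X]) =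
      C (binomPMF n p m) * X ^ m := by
    simp only [binomPMF, map_mul, map_pow, map_natCast]
    ring
  rw [bernoulliGF, add_pow, Finset.sum_congr rfl fun m _ => hterm m]
  simp only [finsetSum_coeff, coeff_C_mul_X_pow, Finset.sum_ite_eq, Finset.mem_range]
  split_ifs with h
  · rfl
  · simp [binomPMF, Nat.choose_eq_zero_of_lt (by lia : n < k)]

open Polynomial in
lemma nconv_coeff (F G : ℝ[X]) : nconv F.coeff G.coeff = (F * G).coeff := by
  funext k
  rw [coeff_mul, nconv, Finset.Nat.sum_antidiagonal_eq_sum_range_succ_mk]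

open Polynomial in
lemma gfDominates_bernoulliGF {p q : ℝ} (h : q ≤ p) :
    GFDominates (bernoulliGF p) (bernoulliGF q) := by
  refine ⟨C (p - q), fun i => ?_, ?_⟩
  · rw [coeff_C]
    split_ifs <;> simp [h]
  · simp only [bernoulliGF, map_sub, map_one]
    ring

open Polynomial in
lemma GFDominates.refl (F : ℝ[X]) : GFDominates F F :=
  ⟨0, by simp, by simp⟩

open Polynomial in
lemma GFDominates.mul {F F' G G' : ℝ[X]} (hF : ∀ i, 0 ≤ F.coeff i) (hG' : ∀ i, 0 ≤ G'.coeff i)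
    (h : GFDominates F G) (h' : GFDominates F' G') : GFDominates (F * F') (G * G') := by
  obtain ⟨H, hH, e⟩ := h
  obtain ⟨H', hH', e'⟩ := h'
  refine ⟨F * H' + H * G', fun i => ?_, ?_⟩
  · rw [coeff_add]
    exact add_nonneg (coeff_mul_nonneg hF hH' i) (coeff_mul_nonneg hH hG' i)
  · linear_combination F * e' + G' * e

open Polynomial in
lemma GFDominates.pow {F G : ℝ[X]} (hF : ∀ i, 0 ≤ F.coeff i) (hG : ∀ i, 0 ≤ G.coeff i)
    (h : GFDominates F G) (n : ℕ) : GFDominates (F ^ n) (G ^ n) := by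
  induction n with
  | zero => simpa using GFDominates.refl 1
  | succ n ih =>
    simpa only [pow_succ] using GFDominates.mul (coeff_pow_nonneg hF n) hG ih h

open Polynomial in
lemma tsum_tail_coeff {F : ℝ[X]} {N : ℕ} (hN : F.natDegree < N) (t : ℝ) :
    ∑' k : ℕ, (if t ≤ (k : ℝ) then F.coeff k else 0) =
      ∑ k ∈ Finset.range N, (if t ≤ (k : ℝ) then F.coeff k else 0) := by
  refine tsum_eq_sum fun k hk => ?_
  rw [Finset.mem_range, not_lt] at hk
  simp [coeff_eq_zero_of_natDegree_lt (hN.trans_le hk)]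

open Polynomial in
lemma GFDominates.fosd {F G : ℝ[X]} (h : GFDominates F G) : FOSD F.coeff G.coeff := by
  intro t
  obtain ⟨H, hH, e⟩ := h
  obtain ⟨N, hF, hG, hN⟩ : ∃ N, F.natDegree < N + 1 ∧ G.natDegree < N + 1 ∧ H.natDegree < N :=
    ⟨F.natDegree + G.natDegree + H.natDegree + 1, by lia, by lia, by lia⟩
  rw [tsum_tail_coeff hF, tsum_tail_coeff hG, ← sub_nonneg, ← Finset.sum_sub_distrib]
  have hcoeff (k : ℕ) : (if t ≤ (k : ℝ) then F.coeff k else 0) -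
      (if t ≤ (k : ℝ) then G.coeff k else 0) =
      (if t ≤ (k : ℝ) then (X * H).coeff k else 0) - (if t ≤ (k : ℝ) then H.coeff k else 0) := by
    have : F.coeff k - G.coeff k = (X * H).coeff k - H.coeff k := by
      rw [← coeff_sub, ← coeff_sub, e, sub_mul, one_mul]
    split_ifs
    · exact this
    · rfl
  rw [Finset.sum_congr rfl fun k _ => hcoeff k, Finset.sum_sub_distrib, Finset.sum_range_succ',
    Finset.sum_range_succ, coeff_eq_zero_of_natDegree_lt hN]
  simp only [coeff_X_mul, coeff_X_mul_zero, ite_self, add_zero]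
  rw [sub_nonneg]
  refine Finset.sum_le_sum fun k _ => ?_
  have := hH k
  split_ifs with h1 h2
  · exact le_rfl
  · push_cast at h2
    linarith
  · exact this
  · exact le_rfl

/-- The distributional content of SD-truthfulness of the Enforced Agreement
mechanism in the binary-signal setting: if `p₀₀ ≥ p₁₀` and `p₁₁ ≥ p₀₁`, then
`Bin(n₀, p₀₀) + Bin(m₁, p₁₁) + Bin(m₀ − n₀, p₀₁)` (the truth-telling score)
first-order stochastically dominates
`Bin(n₀ − k, p₀₀) + Bin(m₁ − k, p₁₁) + Bin(m₀ − n₀ + k, p₀₁) + Bin(k, p₁₀)`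
(the score of a deviation moving `k` reports), for every `0 ≤ k ≤ min(n₀, m₁)`. -/
theorem ea_binary_sd_truthful
    (p00 p01 p10 p11 : ℝ)
    (h00 : 0 ≤ p00) (h00' : p00 ≤ 1) (h01 : 0 ≤ p01) (h01' : p01 ≤ 1)
    (h10 : 0 ≤ p10) (h10' : p10 ≤ 1) (h11 : 0 ≤ p11) (h11' : p11 ≤ 1)
    (hsp0 : p10 ≤ p00) (hsp1 : p01 ≤ p11)
    (n0 m0 m1 k : ℕ) (hnm : n0 ≤ m0) (hk : k ≤ min n0 m1) :
    FOSD
      (nconv (nconv (binomPMF n0 p00) (binomPMF m1 p11)) (binomPMF (m0 - n0) p01))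
      (nconv (nconv (nconv (binomPMF (n0 - k) p00) (binomPMF (m1 - k) p11))
        (binomPMF (m0 - n0 + k) p01)) (binomPMF k p10)) := by
  obtain ⟨hk0, hk1⟩ := le_min_iff.1 hk
  have b00 := coeff_bernoulliGF_nonneg h00 h00'
  have b01 := coeff_bernoulliGF_nonneg h01 h01'
  have b10 := coeff_bernoulliGF_nonneg h10 h10'
  have b11 := coeff_bernoulliGF_nonneg h11 h11'
  simp only [binomPMF_eq_coeff, nconv_coeff]
  have hmoved := ((gfDominates_bernoulliGF hsp0).mul b00 b01 (gfDominates_bernoulliGF hsp1)).pow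
    (coeff_mul_nonneg b00 b11) (coeff_mul_nonneg b10 b01) k
  have hdom := (GFDominates.refl (bernoulliGF p00 ^ (n0 - k) * bernoulliGF p11 ^ (m1 - k) *
    bernoulliGF p01 ^ (m0 - n0))).mul
    (coeff_mul_nonneg (coeff_mul_nonneg (coeff_pow_nonneg b00 _) (coeff_pow_nonneg b11 _))
      (coeff_pow_nonneg b01 _))
    (coeff_pow_nonneg (coeff_mul_nonneg b10 b01) k) hmoved
  convert hdom.fosd using 2
  · rw [← Nat.sub_add_cancel hk0, ← Nat.sub_add_cancel hk1]
    simp only [Nat.add_sub_cancel, pow_add, mul_pow]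
    ring
  · simp only [pow_add, mul_pow]
    ring
end

section
/- Let p : {0,1,2}×{0,1,2} → [0,1] be uniformly self-predicting: for every j and every pair of distinct i, k both different from j, p_{jj} > p_{ij} and p_{ij} = p_{kj}. Let m = (m_0,m_1,m_2) and n = (n_0,n_1,n_2) be nonnegative integer vectors with m_0 + m_1 + m_2 = n_0 + n_1 + n_2, m_0 ≥ n_0, m_1 ≤ n_1 and m_2 ≤ n_2. Define the truthful manipulation matrix ϑ^τ with rows (n_0, n_1 − m_1, n_2 − m_2), (0, m_1, 0), (0, 0, m_2). Then for every matrix ϑ of nonnegative integers with row sums Σ_j ϑ_{ij} = m_i for each i and column sums Σ_i ϑ_{ij} = n_j for each j, the distribution of the sum of independent binomials Σ_{i,j} Bin(ϑ^τ_{ij}, p_{ij}) first-order stochastically dominates the distribution of Σ_{i,j} Bin(ϑ_{ij}, p_{ij}). (Sufficiency direction of the three-signal EA result, case of one over-reported signal.) -/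
/-- The mass function of `Σ_{i,j ∈ {0,1,2}} Bin(a i j, p i j)`, a sum of nine
independent binomial random variables. -/
noncomputable def binomSum3 (a : Fin 3 → Fin 3 → ℕ) (p : Fin 3 → Fin 3 → ℝ) : ℕ → ℝ :=
  nconv (binomPMF (a 0 0) (p 0 0)) <|
  nconv (binomPMF (a 0 1) (p 0 1)) <|
  nconv (binomPMF (a 0 2) (p 0 2)) <|
  nconv (binomPMF (a 1 0) (p 1 0)) <|
  nconv (binomPMF (a 1 1) (p 1 1)) <|
  nconv (binomPMF (a 1 2) (p 1 2)) <|
  nconv (binomPMF (a 2 0) (p 2 0)) <|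
  nconv (binomPMF (a 2 1) (p 2 1)) <|
  binomPMF (a 2 2) (p 2 2)

open Polynomial in
/-- The probability generating function of a Bernoulli variable with parameter `q`. -/
noncomputable def bernoulliPGF (q : ℝ) : ℝ[X] := C q * X + C (1 - q)

open Polynomial in
/-- `P` dominates `Q` when `Q - P = (1 - X) * R` for some `R` with nonnegative coefficients;
for probability generating functions this is first-order stochastic dominance. -/
def PGFDominates (P Q : ℝ[X]) : Prop :=
  ∃ R : ℝ[X], (∀ k, 0 ≤ R.coeff k) ∧ Q = P + (1 - X) * R

section PGF

open Polynomial

theorem coeff_mul_nonneg_s8 {P Q : ℝ[X]} (hP : ∀ k, 0 ≤ P.coeff k) (hQ : ∀ k, 0 ≤ Q.coeff k)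
    (k : ℕ) : 0 ≤ (P * Q).coeff k := by
  rw [coeff_mul]
  exact Finset.sum_nonneg fun x _ => mul_nonneg (hP _) (hQ _)

theorem coeff_bernoulliPGF_pow (n : ℕ) (q : ℝ) (k : ℕ) :
    (bernoulliPGF q ^ n).coeff k = binomPMF n q k := by
  have h (i : ℕ) : ((C q * X) ^ i * C (1 - q) ^ (n - i) * (n.choose i : ℝ[X])).coeff k =
      if k = i then (n.choose i : ℝ) * q ^ i * (1 - q) ^ (n - i) else 0 := by
    have : (C q * X) ^ i * C (1 - q) ^ (n - i) * (n.choose i : ℝ[X]) =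
        C ((n.choose i : ℝ) * q ^ i * (1 - q) ^ (n - i)) * X ^ i := by
      simp only [map_mul, map_pow, map_natCast]
      ring
    rw [this, coeff_C_mul_X_pow]
  rw [bernoulliPGF, add_pow, finsetSum_coeff, binomPMF]
  simp only [h, Finset.sum_ite_eq, Finset.mem_range]
  split_ifs with hk
  · rfl
  · simp [Nat.choose_eq_zero_of_lt (show n < k by omega)]

theorem coeff_bernoulliPGF_pow_nonneg {q : ℝ} (h0 : 0 ≤ q) (h1 : q ≤ 1) (n k : ℕ) :
    0 ≤ (bernoulliPGF q ^ n).coeff k := by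
  rw [coeff_bernoulliPGF_pow, binomPMF]
  have := sub_nonneg.mpr h1
  positivity

theorem coeff_bernoulliPGF_nonneg {q : ℝ} (h0 : 0 ≤ q) (h1 : q ≤ 1) (k : ℕ) :
    0 ≤ (bernoulliPGF q).coeff k := by
  simpa using coeff_bernoulliPGF_pow_nonneg h0 h1 1 k

theorem nconv_coeff_s8 (P Q : ℝ[X]) : nconv P.coeff Q.coeff = (P * Q).coeff := by
  funext k
  rw [nconv, coeff_mul, Finset.Nat.sum_antidiagonal_eq_sum_range_succ
    (fun i j => P.coeff i * Q.coeff j)]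

theorem binomSum3_eq_coeff (a : Fin 3 → Fin 3 → ℕ) (p : Fin 3 → Fin 3 → ℝ) :
    binomSum3 a p = (∏ j, ∏ i, bernoulliPGF (p i j) ^ a i j).coeff := by
  have h (n : ℕ) (q : ℝ) : binomPMF n q = (bernoulliPGF q ^ n).coeff :=
    funext fun k => (coeff_bernoulliPGF_pow n q k).symm
  simp only [binomSum3, h, nconv_coeff_s8, Fin.prod_univ_three]
  congr 1
  ring

namespace PGFDominates

theorem refl (P : ℝ[X]) : PGFDominates P P := ⟨0, by simp, by simp⟩

theorem trans {P Q S : ℝ[X]} : PGFDominates P Q → PGFDominates Q S → PGFDominates P S := by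
  rintro ⟨R, hR, rfl⟩ ⟨T, hT, rfl⟩
  refine ⟨R + T, fun k => ?_, by ring⟩
  rw [coeff_add]
  exact add_nonneg (hR k) (hT k)

theorem mul {P P' Q Q' : ℝ[X]} (hP : ∀ k, 0 ≤ P.coeff k) (hQ' : ∀ k, 0 ≤ Q'.coeff k) :
    PGFDominates P Q → PGFDominates P' Q' → PGFDominates (P * P') (Q * Q') := by
  rintro ⟨R, hR, rfl⟩ ⟨R', hR', h⟩
  refine ⟨R * Q' + P * R', fun k => ?_, by rw [add_mul, h]; ring⟩
  rw [coeff_add]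
  exact add_nonneg (coeff_mul_nonneg_s8 hR hQ' k) (coeff_mul_nonneg_s8 hP hR' k)

theorem pow {P Q : ℝ[X]} (hP : ∀ k, 0 ≤ P.coeff k) (hQ : ∀ k, 0 ≤ Q.coeff k)
    (h : PGFDominates P Q) (n : ℕ) : PGFDominates (P ^ n) (Q ^ n) := by
  have hpow (n : ℕ) (k : ℕ) : 0 ≤ (P ^ n).coeff k := by
    induction n generalizing k with
    | zero => rw [pow_zero, coeff_one]; positivity
    | succ n ih => rw [pow_succ]; exact coeff_mul_nonneg_s8 ih hP k
  induction n with
  | zero => simpa using refl 1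
  | succ n ih => rw [pow_succ, pow_succ]; exact ih.mul (hpow n) hQ h

theorem bernoulliPGF {q d : ℝ} (h : q ≤ d) :
    PGFDominates (bernoulliPGF d) (bernoulliPGF q) := by
  refine ⟨C (d - q), fun k => ?_, ?_⟩
  · rw [coeff_C]
    split_ifs <;> linarith
  · simp only [_root_.bernoulliPGF, map_sub, map_one]
    ring

theorem fosd {P Q : ℝ[X]} (h : PGFDominates P Q) : FOSD P.coeff Q.coeff := by
  obtain ⟨R, hR, rfl⟩ := h
  intro t
  have hs (S : ℝ[X]) (t : ℝ) : Summable fun k : ℕ => if t ≤ (k : ℝ) then S.coeff k else 0 :=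
    summable_of_ne_finset_zero (s := S.support) fun k hk => by
      simp [notMem_support_iff.mp hk]
  have hX : ∑' k : ℕ, (if t ≤ (k : ℝ) then (X * R).coeff k else 0) =
      ∑' k : ℕ, (if t ≤ ((k + 1 : ℕ) : ℝ) then R.coeff k else 0) := by
    rw [(hs (X * R) t).tsum_eq_zero_add]
    simp
  have hsub : ∑' k : ℕ, (if t ≤ (k : ℝ) then (P + (1 - X) * R).coeff k else 0) =
      ∑' k : ℕ, (if t ≤ (k : ℝ) then P.coeff k else 0) +
      (∑' k : ℕ, (if t ≤ (k : ℝ) then R.coeff k else 0) -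
      ∑' k : ℕ, (if t ≤ (k : ℝ) then (X * R).coeff k else 0)) := by
    rw [← (hs R t).tsum_sub (hs (X * R) t), ← (hs P t).tsum_add ((hs R t).sub (hs (X * R) t))]
    refine tsum_congr fun k => ?_
    split_ifs <;> simp [sub_mul]
  have hle : ∑' k : ℕ, (if t ≤ (k : ℝ) then R.coeff k else 0) ≤
      ∑' k : ℕ, (if t ≤ ((k + 1 : ℕ) : ℝ) then R.coeff k else 0) := by
    refine (hs R t).tsum_le_tsum (fun k => ?_) ?_
    · have := hR k
      push_cast
      split_ifs <;> linarith
    · simpa [sub_le_iff_le_add] using hs R (t - 1)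
  linarith

end PGFDominates

/-- Moving trials from the smaller success probability `q` to the larger one `d` increases the
sum of two binomials stochastically. -/
theorem pgfDominates_of_le {q d : ℝ} (hq : 0 ≤ q) (hqd : q ≤ d) (hd : d ≤ 1)
    {a a' b b' : ℕ} (ha : a ≤ b) (hab : a + a' = b + b') :
    PGFDominates (bernoulliPGF d ^ b * bernoulliPGF q ^ b')
      (bernoulliPGF d ^ a * bernoulliPGF q ^ a') := by
  obtain ⟨c, rfl⟩ := Nat.exists_eq_add_of_le ha
  obtain rfl : a' = c + b' := by omega
  have hd0 := hq.trans hqd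
  have hq1 := hqd.trans hd
  rw [pow_add, pow_add, mul_assoc]
  refine (PGFDominates.refl _).mul (coeff_bernoulliPGF_pow_nonneg hd0 hd a)
    (coeff_mul_nonneg_s8 (coeff_bernoulliPGF_pow_nonneg hq hq1 c)
      (coeff_bernoulliPGF_pow_nonneg hq hq1 b')) ?_
  exact ((PGFDominates.bernoulliPGF hqd).pow (coeff_bernoulliPGF_nonneg hd0 hd)
    (coeff_bernoulliPGF_nonneg hq hq1) c).mul (coeff_bernoulliPGF_pow_nonneg hd0 hd c)
    (coeff_bernoulliPGF_pow_nonneg hq hq1 b') (PGFDominates.refl _)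

end PGF

/-- Under a uniformly self-predicting `p`, enlarging the diagonal of a manipulation matrix with
fixed column sums increases the score stochastically. -/
theorem fosd_binomSum3_of_diag_le {p : Fin 3 → Fin 3 → ℝ}
    (hp0 : ∀ i j, 0 ≤ p i j) (hp1 : ∀ i j, p i j ≤ 1)
    (husp1 : ∀ i j, i ≠ j → p i j < p j j)
    (husp2 : ∀ i j k, i ≠ j → k ≠ j → p i j = p k j)
    {a b : Fin 3 → Fin 3 → ℕ} (hdiag : ∀ j, a j j ≤ b j j)
    (hcol : ∀ j, ∑ i, a i j = ∑ i, b i j) :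
    FOSD (binomSum3 b p) (binomSum3 a p) := by
  have hnonneg (c : Fin 3 → Fin 3 → ℕ) (j : Fin 3) (k : ℕ) :
      0 ≤ (∏ i, bernoulliPGF (p i j) ^ c i j).coeff k := by
    have h (i : Fin 3) := coeff_bernoulliPGF_pow_nonneg (hp0 i j) (hp1 i j) (c i j)
    rw [Fin.prod_univ_three]
    exact coeff_mul_nonneg_s8 (coeff_mul_nonneg_s8 (h 0) (h 1)) (h 2) k
  have hdom (j : Fin 3) : PGFDominates (∏ i, bernoulliPGF (p i j) ^ b i j)
      (∏ i, bernoulliPGF (p i j) ^ a i j) := by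
    have hne : j + 1 ≠ j := by simp
    have hsplit (c : Fin 3 → Fin 3 → ℕ) : ∏ i, bernoulliPGF (p i j) ^ c i j =
        bernoulliPGF (p j j) ^ c j j *
          bernoulliPGF (p (j + 1) j) ^ ∑ i ∈ Finset.univ.erase j, c i j := by
      rw [← Finset.mul_prod_erase _ _ (Finset.mem_univ j), ← Finset.prod_pow_eq_pow_sum]
      congr 1
      refine Finset.prod_congr rfl fun i hi => ?_
      rw [husp2 i j (j + 1) (Finset.ne_of_mem_erase hi) hne]
    rw [hsplit, hsplit]
    refine pgfDominates_of_le (hp0 _ _) (husp1 _ _ hne).le (hp1 _ _) (hdiag j) ?_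
    rw [Finset.add_sum_erase _ (fun i => a i j) (Finset.mem_univ j),
      Finset.add_sum_erase _ (fun i => b i j) (Finset.mem_univ j), hcol]
  rw [binomSum3_eq_coeff, binomSum3_eq_coeff,
    Fin.prod_univ_three (fun j => ∏ i, bernoulliPGF (p i j) ^ b i j),
    Fin.prod_univ_three (fun j => ∏ i, bernoulliPGF (p i j) ^ a i j)]
  have h01 := (hdom 0).mul (hnonneg b 0) (hnonneg a 1) (hdom 1)
  have h012 := h01.mul (coeff_mul_nonneg_s8 (hnonneg b 0) (hnonneg b 1)) (hnonneg a 2) (hdom 2)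
  exact h012.fosd

/-- Sufficiency direction of the three-signal Enforced Agreement result, case of
one over-reported signal: with uniformly self-predicting `p`, `m₀ ≥ n₀`, `m₁ ≤ n₁`,
`m₂ ≤ n₂`, the truthful manipulation matrix `ϑ^τ` (under the minimal enforcement
rule) yields a score distribution that FOSD-dominates the one of every feasible
manipulation matrix `ϑ`. -/
theorem ea_three_signal_one_over
    (p : Fin 3 → Fin 3 → ℝ)
    (hp0 : ∀ i j, 0 ≤ p i j) (hp1 : ∀ i j, p i j ≤ 1)
    (husp1 : ∀ i j, i ≠ j → p i j < p j j)
    (husp2 : ∀ i j k, i ≠ j → k ≠ j → p i j = p k j)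
    (m n : Fin 3 → ℕ)
    (hsum : ∑ i, m i = ∑ j, n j)
    (h0 : n 0 ≤ m 0) (h1 : m 1 ≤ n 1) (h2 : m 2 ≤ n 2)
    (ϑ : Fin 3 → Fin 3 → ℕ)
    (hrow : ∀ i, ∑ j, ϑ i j = m i)
    (hcol : ∀ j, ∑ i, ϑ i j = n j) :
    FOSD
      (binomSum3 ![![n 0, n 1 - m 1, n 2 - m 2], ![0, m 1, 0], ![0, 0, m 2]] p)
      (binomSum3 ϑ p) := by
  have hle (i j : Fin 3) : ϑ i j ≤ m i ∧ ϑ i j ≤ n j :=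
    ⟨hrow i ▸ Finset.single_le_sum (f := fun j => ϑ i j) (by simp) (Finset.mem_univ j),
      hcol j ▸ Finset.single_le_sum (f := fun i => ϑ i j) (by simp) (Finset.mem_univ i)⟩
  refine fosd_binomSum3_of_diag_le hp0 hp1 husp1 husp2 (fun j => ?_) (fun j => ?_)
  · fin_cases j
    · exact (hle 0 0).2
    · exact (hle 1 1).1
    · exact (hle 2 2).1
  · rw [hcol]
    fin_cases j <;> simp [Fin.sum_univ_three, h1, h2]
end

section
/- Let n be a positive integer, q ∈ [0,1], b(m) = C(n,m)·q^m·(1−q)^{n−m} the binomial probability mass function, and F(k) = Σ_{m=0}^{k} b(m) its cumulative distribution function. Let η'_{00}, η'_{01}, η'_{10}, η'_{11} be real numbers with A := η'_{00} − η'_{01} > 0 and B := η'_{11} − η'_{10} > 0. Define g(n_0) = Σ_{m_0=0}^{n_0} b(m_0)·(m_0·η'_{00} + (n − n_0)·η'_{11} + (n_0 − m_0)·η'_{10}) + Σ_{m_0=n_0+1}^{n} b(m_0)·(n_0·η'_{00} + (n − m_0)·η'_{11} + (m_0 − n_0)·η'_{01}) for n_0 ∈ {0,…,n}. Then for every 0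 ≤ n_0 < n: (a) g(n_0 + 1) − g(n_0) = F(n_0)·(η'_{10} − η'_{11}) + (1 − F(n_0))·(η'_{00} − η'_{01}); (b) g(n_0 + 1) > g(n_0) if and only if F(n_0) < A/(A + B); and (c) the increments g(n_0 + 1) − g(n_0) are non-increasing in n_0. (Characterization of the sensitivity-maximizing enforcement of the binary Enforced Agreement mechanism.) -/
/-- The binomial probability masses sum to one. -/
theorem sum_binomial_mass (n : ℕ) (q : ℝ) :
    ∑ m ∈ Finset.range (n + 1), (n.choose m : ℝ) * q ^ m * (1 - q) ^ (n - m) = 1 := by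
  have h := add_pow q (1 - q) n
  rw [add_sub_cancel, one_pow] at h
  refine Eq.trans ?_ h.symm
  exact Finset.sum_congr rfl fun m _ => by ring

theorem sum_Icc_eq_head_add {M : Type*} [AddCommMonoid M] (f : ℕ → M) {k n : ℕ} (hk : k ≤ n) :
    ∑ m ∈ Finset.Icc k n, f m = f k + ∑ m ∈ Finset.Icc (k + 1) n, f m := by
  rw [← Finset.insert_Icc_add_one_left_eq_Icc hk, Finset.sum_insert (by simp)]

theorem sum_range_add_sum_Icc {M : Type*} [AddCommMonoid M] (f : ℕ → M) {k n : ℕ} (hk : k ≤ n) :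
    ∑ m ∈ Finset.range (k + 1), f m + ∑ m ∈ Finset.Icc (k + 1) n, f m =
      ∑ m ∈ Finset.range (n + 1), f m := by
  rw [← Finset.sum_range_add_sum_Ico f (Nat.succ_le_succ hk)]
  rfl

/-- The increment of the enforced-agreement objective, for arbitrary weights `b`. -/
theorem enforcement_increment (b : ℕ → ℝ) (η00 η01 η10 η11 : ℝ) {n k : ℕ} (hk : k < n) :
    ((∑ m ∈ Finset.range (k + 1 + 1),
        b m * ((m : ℝ) * η00 + ((n : ℝ) - (k + 1 : ℕ)) * η11 + (((k + 1 : ℕ) : ℝ) - m) * η10)) +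
      ∑ m ∈ Finset.Icc (k + 1 + 1) n,
        b m * (((k + 1 : ℕ) : ℝ) * η00 + ((n : ℝ) - m) * η11 + ((m : ℝ) - (k + 1 : ℕ)) * η01)) -
    ((∑ m ∈ Finset.range (k + 1),
        b m * ((m : ℝ) * η00 + ((n : ℝ) - k) * η11 + ((k : ℝ) - m) * η10)) +
      ∑ m ∈ Finset.Icc (k + 1) n,
        b m * ((k : ℝ) * η00 + ((n : ℝ) - m) * η11 + ((m : ℝ) - k) * η01)) =
    (∑ m ∈ Finset.range (k + 1), b m) * (η10 - η11) +
      (∑ m ∈ Finset.Icc (k + 1) n, b m) * (η00 - η01) := by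
  have hlow : (∑ m ∈ Finset.range (k + 1),
        b m * ((m : ℝ) * η00 + ((n : ℝ) - (k + 1 : ℕ)) * η11 + (((k + 1 : ℕ) : ℝ) - m) * η10)) =
      (∑ m ∈ Finset.range (k + 1),
        b m * ((m : ℝ) * η00 + ((n : ℝ) - k) * η11 + ((k : ℝ) - m) * η10)) +
      (∑ m ∈ Finset.range (k + 1), b m) * (η10 - η11) := by
    rw [Finset.sum_mul, ← Finset.sum_add_distrib]
    exact Finset.sum_congr rfl fun m _ => by push_cast; ring
  have hhigh : (∑ m ∈ Finset.Icc (k + 1 + 1) n,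
        b m * (((k + 1 : ℕ) : ℝ) * η00 + ((n : ℝ) - m) * η11 + ((m : ℝ) - (k + 1 : ℕ)) * η01)) =
      (∑ m ∈ Finset.Icc (k + 1 + 1) n,
        b m * ((k : ℝ) * η00 + ((n : ℝ) - m) * η11 + ((m : ℝ) - k) * η01)) +
      (∑ m ∈ Finset.Icc (k + 1 + 1) n, b m) * (η00 - η01) := by
    rw [Finset.sum_mul, ← Finset.sum_add_distrib]
    exact Finset.sum_congr rfl fun m _ => by push_cast; ring
  rw [Finset.sum_range_succ _ (k + 1), hlow, hhigh, sum_Icc_eq_head_add b hk,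
    sum_Icc_eq_head_add (fun m : ℕ => b m * ((k : ℝ) * η00 + ((n : ℝ) - m) * η11 +
      ((m : ℝ) - k) * η01)) hk]
  push_cast
  ring

/-- Characterization of the sensitivity-maximizing enforcement of the binary
Enforced Agreement mechanism.  Here `b` is the binomial pmf with success
probability `q`, `F` its cdf, and `g n₀` is (`n` times) the derivative in effort
of the expected EA score under enforcement `(n₀, n − n₀)`.  For every `n₀ < n`:
(a) `g(n₀+1) − g(n₀) = F(n₀)(η₁₀' − η₁₁') + (1 − F(n₀))(η₀₀' − η₀₁')`;
(b) `g(n₀+1) > g(n₀)` iff `F(n₀) < A/(A + B)` where `A = η₀₀' − η₀₁' > 0` and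
`B = η₁₁' − η₁₀' > 0`; and (c) the increments of `g` are non-increasing. -/
theorem ea_optimal_enforcement
    (n : ℕ) (hn : 1 ≤ n) (q : ℝ) (hq0 : 0 ≤ q) (hq1 : q ≤ 1)
    (η00 η01 η10 η11 : ℝ)
    (hA : 0 < η00 - η01) (hB : 0 < η11 - η10) :
    let b : ℕ → ℝ := fun m => (n.choose m : ℝ) * q ^ m * (1 - q) ^ (n - m)
    let F : ℕ → ℝ := fun k => ∑ m ∈ Finset.range (k + 1), b m
    let g : ℕ → ℝ := fun n0 =>
      (∑ m0 ∈ Finset.range (n0 + 1),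
        b m0 * ((m0 : ℝ) * η00 + ((n : ℝ) - n0) * η11 + ((n0 : ℝ) - m0) * η10)) +
      ∑ m0 ∈ Finset.Icc (n0 + 1) n,
        b m0 * ((n0 : ℝ) * η00 + ((n : ℝ) - m0) * η11 + ((m0 : ℝ) - n0) * η01)
    (∀ n0 < n, g (n0 + 1) - g n0
        = F n0 * (η10 - η11) + (1 - F n0) * (η00 - η01)) ∧
    (∀ n0 < n, (g n0 < g (n0 + 1) ↔
        F n0 < (η00 - η01) / ((η00 - η01) + (η11 - η10)))) ∧
    (∀ n0, n0 + 1 < n → g (n0 + 2) - g (n0 + 1) ≤ g (n0 + 1) - g n0) := by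
  intro b F g
  have increment : ∀ k < n, g (k + 1) - g k =
      F k * (η10 - η11) + (1 - F k) * (η00 - η01) := by
    intro k hk
    have htail : ∑ m ∈ Finset.Icc (k + 1) n, b m = 1 - F k :=
      eq_sub_of_add_eq' ((sum_range_add_sum_Icc b hk.le).trans (sum_binomial_mass n q))
    rw [← htail]
    exact enforcement_increment b η00 η01 η10 η11 hk
  refine ⟨increment, fun k hk => ?_, fun k hk => ?_⟩
  · rw [← sub_pos, increment k hk, lt_div_iff₀ (add_pos hA hB)]
    constructor <;> intro h <;> linarith
  · rw [increment (k + 1) hk, increment k (by lia)]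
    have hb : 0 ≤ b (k + 1) :=
      mul_nonneg (mul_nonneg (Nat.cast_nonneg _) (pow_nonneg hq0 _))
        (pow_nonneg (sub_nonneg.2 hq1) _)
    have hF : F (k + 1) = F k + b (k + 1) := Finset.sum_range_succ b (k + 1)
    rw [hF]
    linarith [mul_nonneg hb (add_pos hA hB).le]
end

section
/- Let J be a joint probability mass function on {0,1}×{0,1} with marginals M^a(σ) = Σ_{σ'} J(σ,σ') > 0 and M^b(σ') = Σ_σ J(σ,σ') > 0, and suppose signals are self-predicting: for each σ and σ' ≠ σ, J(σ,σ)/M^a(σ) > J(σ',σ)/M^a(σ'). For a strategy θ : {0,1} → (probability vectors on {0,1}), define the individual Correlated Agreement score S(θ) ∈ {−1,0,1} as follows: draw (X_a, X_b) ∼ J, independently draw X_b' ∼ M^b, draw the report r ∼ θ(X_a), and set S(θ) = 1[r = X_b] − 1[r = X_b']. Then for every strategy θ: Pr(S(τ) = 1) ≥ Pr(S(θ) = 1) and Pr(S(τ) = −1) ≤ Pr(S(θ) = −1), where τ is truth-telling; consequently S(τ) first-order stochastically dominates S(θ). (A single individual CA score is SD-truthful in the binary-signal setting.) -/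
/-- The truth-telling strategy: report the received signal with probability one. -/
noncomputable def truthful : Fin 2 → Fin 2 → ℝ := fun σ r => if r = σ then 1 else 0

/-- `Pr(S(θ) = 1)` for the individual Correlated Agreement score: draw
`(X_a, X_b) ∼ J`, independently `X_b' ∼ M^b`, a report `r ∼ θ(X_a)`, and score
`S(θ) = 1[r = X_b] − 1[r = X_b']`. -/
noncomputable def caProbOne (J θ : Fin 2 → Fin 2 → ℝ) : ℝ :=
  ∑ xa, ∑ xb, ∑ xb', ∑ r,
    J xa xb * (∑ x, J x xb') * θ xa r * (if r = xb ∧ r ≠ xb' then 1 else 0)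

/-- `Pr(S(θ) = −1)` for the individual Correlated Agreement score. -/
noncomputable def caProbNegOne (J θ : Fin 2 → Fin 2 → ℝ) : ℝ :=
  ∑ xa, ∑ xb, ∑ xb', ∑ r,
    J xa xb * (∑ x, J x xb') * θ xa r * (if r ≠ xb ∧ r = xb' then 1 else 0)

/-- Truth-telling gains over `θ`, in the probability of scoring `1`, the probability mass that `θ`
puts on misreports times the determinant of the joint distribution. -/
lemma caProbOne_truthful_sub (J θ : Fin 2 → Fin 2 → ℝ) (hθ1 : ∀ σ, ∑ r, θ σ r = 1) :
    caProbOne J truthful - caProbOne J θ =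
      (θ 0 1 + θ 1 0) * (J 0 0 * J 1 1 - J 0 1 * J 1 0) := by
  have h0 : θ 0 0 = 1 - θ 0 1 := by linarith [hθ1 0, Fin.sum_univ_two (θ 0)]
  have h1 : θ 1 1 = 1 - θ 1 0 := by linarith [hθ1 1, Fin.sum_univ_two (θ 1)]
  simp [caProbOne, truthful, Fin.sum_univ_two, h0, h1]
  ring

/-- Truth-telling reduces the probability of scoring `-1`, relative to `θ`, by the same amount by
which it raises the probability of scoring `1`. -/
lemma caProbNegOne_sub_truthful (J θ : Fin 2 → Fin 2 → ℝ) (hθ1 : ∀ σ, ∑ r, θ σ r = 1) :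
    caProbNegOne J θ - caProbNegOne J truthful =
      (θ 0 1 + θ 1 0) * (J 0 0 * J 1 1 - J 0 1 * J 1 0) := by
  have h0 : θ 0 0 = 1 - θ 0 1 := by linarith [hθ1 0, Fin.sum_univ_two (θ 0)]
  have h1 : θ 1 1 = 1 - θ 1 0 := by linarith [hθ1 1, Fin.sum_univ_two (θ 1)]
  simp [caProbNegOne, truthful, Fin.sum_univ_two, h0, h1]
  ring

/-- A single individual Correlated Agreement score is SD-truthful in the
binary-signal setting with self-predicting signals: for every strategy `θ`,
`Pr(S(τ) = 1) ≥ Pr(S(θ) = 1)` and `Pr(S(τ) = −1) ≤ Pr(S(θ) = −1)`; consequently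
the distribution of `S(τ)` (on `{−1, 0, 1}`) first-order stochastically dominates
that of `S(θ)`. -/
theorem ca_single_score_sd_truthful
    (J : Fin 2 → Fin 2 → ℝ)
    (hJ0 : ∀ σ σ', 0 ≤ J σ σ') (hJ1 : ∑ σ, ∑ σ', J σ σ' = 1)
    (hMa : ∀ σ, 0 < ∑ σ', J σ σ') (hMb : ∀ σ', 0 < ∑ σ, J σ σ')
    (hSP : ∀ σ σ' : Fin 2, σ' ≠ σ →
      J σ' σ / (∑ j, J σ' j) < J σ σ / (∑ j, J σ j))
    (θ : Fin 2 → Fin 2 → ℝ)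
    (hθ0 : ∀ σ r, 0 ≤ θ σ r) (hθ1 : ∀ σ, ∑ r, θ σ r = 1) :
    caProbOne J θ ≤ caProbOne J truthful ∧
    caProbNegOne J truthful ≤ caProbNegOne J θ ∧
    ∀ t : ℝ,
      (if t ≤ 1 then caProbOne J θ else 0)
        + (if t ≤ 0 then 1 - caProbOne J θ - caProbNegOne J θ else 0)
        + (if t ≤ -1 then caProbNegOne J θ else 0)
      ≤ (if t ≤ 1 then caProbOne J truthful else 0)
        + (if t ≤ 0 then 1 - caProbOne J truthful - caProbNegOne J truthful else 0)
        + (if t ≤ -1 then caProbNegOne J truthful else 0) := by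
  have hdet : 0 < J 0 0 * J 1 1 - J 0 1 * J 1 0 := by
    have h := hSP 0 1 (by decide)
    rw [div_lt_div_iff₀ (hMa 1) (hMa 0)] at h
    simp only [Fin.sum_univ_two] at h
    linarith
  have hgain := mul_nonneg (add_nonneg (hθ0 0 1) (hθ0 1 0)) hdet.le
  have hone : caProbOne J θ ≤ caProbOne J truthful := by
    linarith [caProbOne_truthful_sub J θ hθ1]
  have hneg : caProbNegOne J truthful ≤ caProbNegOne J θ := by
    linarith [caProbNegOne_sub_truthful J θ hθ1]
  refine ⟨hone, hneg, fun t => ?_⟩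
  split_ifs <;> linarith
end

section
/- Let J be a joint probability mass function on {0,1}×{0,1} with marginals M^a(σ_1) = Σ_{σ_2} J(σ_1,σ_2) and M^b(σ_2) = Σ_{σ_1} J(σ_1,σ_2), and assume M^b(σ) > 0 for both σ. Define Γ(σ_1,σ_2,σ_3) = J(σ_1,σ_2)/M^b(σ_2) − J(σ_1,σ_3)/M^b(σ_3) and Δ(σ_1,σ_2) = J(σ_1,σ_2) − M^a(σ_1)·M^b(σ_2). Then Σ_{σ_1,σ_2,σ_3 ∈ {0,1}} M^b(σ_2)·M^b(σ_3)·max(Γ(σ_1,σ_2,σ_3), 0) = Σ_{σ_1,σ_2 ∈ {0,1}} max(Δ(σ_1,σ_2), 0). (In the binary-signal setting the Matching Agreement mechanism's positive-part tensor sum reduces to the Correlated Agreement mechanism's positive-part delta sum.) -/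
/-- Clearing the denominators in the positive part of a difference of fractions. -/
lemma mul_mul_max_div_sub_div {p q : ℝ} (hp : 0 < p) (hq : 0 < q) (x y : ℝ) :
    p * q * max (x / p - y / q) 0 = max (x * q - y * p) 0 := by
  rw [mul_max_of_nonneg _ _ (mul_pos hp hq).le, mul_zero]
  congr 1
  field_simp

/-- In the binary-signal setting the Matching Agreement mechanism's
positive-part tensor sum reduces to the Correlated Agreement mechanism's
positive-part delta sum:
`Σ_{σ₁,σ₂,σ₃} M^b(σ₂) M^b(σ₃) (Γ(σ₁,σ₂,σ₃))⁺ = Σ_{σ₁,σ₂} (Δ(σ₁,σ₂))⁺`. -/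
theorem ma_reduces_to_ca_binary
    (J : Fin 2 → Fin 2 → ℝ)
    (hJ0 : ∀ i j, 0 ≤ J i j) (hJ1 : ∑ i, ∑ j, J i j = 1)
    (hMb : ∀ j, 0 < ∑ i, J i j) :
    ∑ σ1, ∑ σ2, ∑ σ3,
      (∑ i, J i σ2) * (∑ i, J i σ3) *
        max (J σ1 σ2 / (∑ i, J i σ2) - J σ1 σ3 / (∑ i, J i σ3)) 0
    = ∑ σ1, ∑ σ2, max (J σ1 σ2 - (∑ j, J σ1 j) * (∑ i, J i σ2)) 0 := by
  simp only [mul_mul_max_div_sub_div (hMb _) (hMb _)]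
  simp only [Fin.sum_univ_two] at hJ1 ⊢
  generalize J 0 0 = a at *
  generalize J 0 1 = b at *
  generalize J 1 0 = c at *
  generalize J 1 1 = d at *
  obtain rfl : d = 1 - a - b - c := by linarith
  ring_nf
  simp
end

section
/- Let J be a joint probability mass function on {0,1}×{0,1} with strictly positive marginals M^a(σ) = Σ_{σ'} J(σ,σ') and M^b(σ') = Σ_σ J(σ,σ'), and let p(j|i) = J(i,j)/M^a(i). Define the delta matrix Δ(σ,σ') = J(σ,σ') − M^a(σ)·M^b(σ'). Then for each σ ∈ {0,1} with σ' = 1 − σ: Δ(σ,σ) = M^a(σ)·M^a(σ')·(p(σ|σ) − p(σ|σ')) and Δ(σ,σ') = M^a(σ)·M^a(σ')·(p(σ'|σ) − p(σ'|σ')). Consequently, signals are self-predicting (p(σ|σ) > p(σ|σ') for every σ' ≠ σ) if and only if Δ has strictly positive diagonal entries and strictly negative off-diagonal entries, i.e., if and only if the Correlated Agreement mechanism's agreement matrix T_Δ = Sign(Δ) is the identity matrix. -/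
/-- For binary signals, the delta matrix `Δ(σ,σ') = J(σ,σ') − M^a(σ)·M^b(σ')`
satisfies, with `p i j = J i j / M^a i` (i.e. `p(j|i)`) and `σ' = 1 − σ`:
`Δ(σ,σ) = M^a(σ)·M^a(σ')·(p(σ|σ) − p(σ|σ'))` and
`Δ(σ,σ') = M^a(σ)·M^a(σ')·(p(σ'|σ) − p(σ'|σ'))`.
Consequently signals are self-predicting iff `Δ` has strictly positive diagonal
and strictly negative off-diagonal entries, i.e. iff the Correlated Agreement
mechanism's agreement matrix `T_Δ = Sign(Δ)` is the identity matrix. -/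
theorem ca_delta_matrix_characterization
    (J : Fin 2 → Fin 2 → ℝ)
    (hJ0 : ∀ i j, 0 ≤ J i j) (hJ1 : ∑ i, ∑ j, J i j = 1)
    (hMa : ∀ i, 0 < ∑ j, J i j) (hMb : ∀ j, 0 < ∑ i, J i j) :
    let Ma : Fin 2 → ℝ := fun i => ∑ j, J i j
    let Mb : Fin 2 → ℝ := fun j => ∑ i, J i j
    let p : Fin 2 → Fin 2 → ℝ := fun i j => J i j / Ma i
    let Δ : Fin 2 → Fin 2 → ℝ := fun i j => J i j - Ma i * Mb j
    (∀ σ : Fin 2, Δ σ σ = Ma σ * Ma (1 - σ) * (p σ σ - p (1 - σ) σ)) ∧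
    (∀ σ : Fin 2, Δ σ (1 - σ)
        = Ma σ * Ma (1 - σ) * (p σ (1 - σ) - p (1 - σ) (1 - σ))) ∧
    ((∀ σ σ' : Fin 2, σ' ≠ σ → p σ' σ < p σ σ) ↔
      ((∀ σ, 0 < Δ σ σ) ∧ (∀ σ σ' : Fin 2, σ ≠ σ' → Δ σ σ' < 0))) ∧
    ((∀ σ σ' : Fin 2, σ' ≠ σ → p σ' σ < p σ σ) ↔
      (∀ σ σ' : Fin 2,
        (if 0 < Δ σ σ' then (1 : ℝ) else 0) = if σ = σ' then 1 else 0)) := by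
  intro Ma Mb p Δ
  have hpos : ∀ i, 0 < Ma i := hMa
  have hMa_eq : ∀ i, Ma i = J i 0 + J i 1 := fun i => Fin.sum_univ_two _
  have hMb_eq : ∀ j, Mb j = J 0 j + J 1 j := fun j => Fin.sum_univ_two _
  have hsum : J 0 0 + J 0 1 + (J 1 0 + J 1 1) = 1 := by
    simpa [Fin.sum_univ_two] using hJ1
  have hsub : ∀ σ j : Fin 2, Ma σ * Ma (1 - σ) * (p σ j - p (1 - σ) j)
      = Ma (1 - σ) * J σ j - Ma σ * J (1 - σ) j := by
    intro σ j
    have h₁ := (hpos σ).ne'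
    have h₂ := (hpos (1 - σ)).ne'
    change Ma σ * Ma (1 - σ) * (J σ j / Ma σ - J (1 - σ) j / Ma (1 - σ)) = _
    field_simp
  have hΔ : ∀ σ j : Fin 2, Δ σ j = Ma σ * Ma (1 - σ) * (p σ j - p (1 - σ) j) := by
    intro σ j
    rw [hsub]
    change J σ j - Ma σ * Mb j = _
    rw [hMa_eq, hMa_eq, hMb_eq]
    fin_cases σ <;> simp <;> linear_combination (-J _ j) * hsum
  have hp : ∀ i, p i 0 + p i 1 = 1 := by
    intro i
    change J i 0 / Ma i + J i 1 / Ma i = 1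
    rw [← add_div, ← hMa_eq, div_self (hpos i).ne']
  have hM : 0 < Ma 0 * Ma 1 := mul_pos (hpos 0) (hpos 1)
  set D := p 0 0 - p 1 0 with hD
  have h00 : Δ 0 0 = Ma 0 * Ma 1 * D := hΔ 0 0
  have h01 : Δ 0 1 = -(Ma 0 * Ma 1 * D) := by
    rw [show Δ 0 1 = Ma 0 * Ma 1 * (p 0 1 - p 1 1) from hΔ 0 1]
    linear_combination Ma 0 * Ma 1 * (hp 0 - hp 1)
  have h10 : Δ 1 0 = -(Ma 0 * Ma 1 * D) := by
    rw [show Δ 1 0 = Ma 1 * Ma 0 * (p 1 0 - p 0 0) from hΔ 1 0]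
    ring
  have h11 : Δ 1 1 = Ma 0 * Ma 1 * D := by
    rw [show Δ 1 1 = Ma 1 * Ma 0 * (p 1 1 - p 0 1) from hΔ 1 1]
    linear_combination Ma 0 * Ma 1 * (hp 1 - hp 0)
  have hself : (∀ σ σ' : Fin 2, σ' ≠ σ → p σ' σ < p σ σ) ↔ 0 < Ma 0 * Ma 1 * D := by
    rw [mul_pos_iff_of_pos_left hM]
    constructor
    · intro h
      exact sub_pos.mpr (h 0 1 (by decide))
    · intro h
      have e0 := hp 0
      have e1 := hp 1
      rw [Fin.forall_fin_two]
      constructor <;> rw [Fin.forall_fin_two] <;> constructor <;> intro hne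
      · exact absurd rfl hne
      · linarith
      · linarith
      · exact absurd rfl hne
  refine ⟨fun σ => hΔ σ σ, fun σ => hΔ σ (1 - σ), hself.trans ?_, hself.trans ?_⟩
  · simp [Fin.forall_fin_two, h00, h01, h10, h11]
  · constructor
    · intro h
      have hn : ¬ Ma 0 * Ma 1 * D < 0 := h.not_gt
      simp [Fin.forall_fin_two, h00, h01, h10, h11, h, hn]
    · intro h
      by_contra hn
      have := h 0 0
      rw [h00, if_neg hn] at this
      simp at this
end
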